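/- Let a, b, c, d ∈ ℂ with a², b², c², d² pairwise distinct, let a', b', c', d' ∈ ℂ, and let O₁, O₂, O₃, O₄ be 2×2 complex matrices each of determinant 1 such that (O₁ ⊗ O₂ ⊗ O₃ ⊗ O₄) · G_{abcd} = κ · G_{a'b'c'd'} for some nonzero κ ∈ ℂ. Then each Oᵢ is a nonzero scalar multiple of an element of the subgroup of GL(2,ℂ) generated by the three matrices Rx = (1/√2)·[[1, −i], [−i, 1]], Ry = (1/√2)·[[1, −1], [1, 1]], Rz = (1/√2)·[[1−i, 0], [0, 1+i]]. (Supplementary Lemma: any local SL(2,ℂ)^{⊗4} operator relating two generic G_{abcd} states has all its local factors in the group 𝒢₂₄.) -/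

import Mathlib

open Complex

/-- The index set of four-qubit basis states. -/
abbrev QIdx4 := Fin 2 × Fin 2 × Fin 2 × Fin 2

/-- The four-qubit state `G_{abcd}`. -/
noncomputable def Gstate (a b c d : ℂ) : QIdx4 → ℂ := fun x =>
  if x = (0, 0, 0, 0) ∨ x = (1, 1, 1, 1) then (a + d) / 2
  else if x = (0, 0, 1, 1) ∨ x = (1, 1, 0, 0) then (a - d) / 2
  else if x = (0, 1, 0, 1) ∨ x = (1, 0, 1, 0) then (b + c) / 2
  else if x = (0, 1, 1, 0) ∨ x = (1, 0, 0, 1) then (b - c) / 2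
  else 0

/-- The action of the local operator `O₁ ⊗ O₂ ⊗ O₃ ⊗ O₄` on four-qubit vectors
(multiplication by the Kronecker product matrix). -/
noncomputable def act4 (O₁ O₂ O₃ O₄ : Matrix (Fin 2) (Fin 2) ℂ) (v : QIdx4 → ℂ) :
    QIdx4 → ℂ := fun x =>
  ∑ y : QIdx4, O₁ x.1 y.1 * O₂ x.2.1 y.2.1 * O₃ x.2.2.1 y.2.2.1 * O₄ x.2.2.2 y.2.2.2 * v y

/-- The spin-1/2 rotation matrix by angle π/2 about the X axis. -/
noncomputable def Rx : Matrix (Fin 2) (Fin 2) ℂ :=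
  ((Real.sqrt 2 : ℂ))⁻¹ • !![1, -I; -I, 1]

/-- The spin-1/2 rotation matrix by angle π/2 about the Y axis. -/
noncomputable def Ry : Matrix (Fin 2) (Fin 2) ℂ :=
  ((Real.sqrt 2 : ℂ))⁻¹ • !![1, -1; 1, 1]

/-- The spin-1/2 rotation matrix by angle π/2 about the Z axis. -/
noncomputable def Rz : Matrix (Fin 2) (Fin 2) ℂ :=
  ((Real.sqrt 2 : ℂ))⁻¹ • !![1 - I, 0; 0, 1 + I]

/-- The subgroup `𝒢₂₄` of `GL(2,ℂ)` generated by `Rx`, `Ry`, `Rz`. -/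
noncomputable def G24 : Subgroup (GL (Fin 2) ℂ) :=
  Subgroup.closure {g : GL (Fin 2) ℂ |
    (g : Matrix (Fin 2) (Fin 2) ℂ) = Rx ∨ (g : Matrix (Fin 2) (Fin 2) ℂ) = Ry ∨
      (g : Matrix (Fin 2) (Fin 2) ℂ) = Rz}

/-- `O` is a nonzero scalar multiple of an element of the group `𝒢₂₄`. -/
noncomputable def IsScalarMultipleOfG24 (O : Matrix (Fin 2) (Fin 2) ℂ) : Prop :=
  ∃ (κ : ℂ) (_ : κ ≠ 0) (g : GL (Fin 2) ℂ) (_ : g ∈ G24),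
    O = κ • (g : Matrix (Fin 2) (Fin 2) ℂ)

open Matrix Kronecker

section ScalarMultiples

variable {A B : Matrix (Fin 2) (Fin 2) ℂ}

lemma IsScalarMultipleOfG24.mul (hA : IsScalarMultipleOfG24 A) (hB : IsScalarMultipleOfG24 B) :
    IsScalarMultipleOfG24 (A * B) := by
  obtain ⟨k, hk, g, hg, rfl⟩ := hA
  obtain ⟨l, hl, e, he, rfl⟩ := hB
  exact ⟨k * l, mul_ne_zero hk hl, g * e, mul_mem hg he, by simp [smul_smul, mul_comm]⟩

lemma IsScalarMultipleOfG24.smul (hA : IsScalarMultipleOfG24 A) {c : ℂ} (hc : c ≠ 0) :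
    IsScalarMultipleOfG24 (c • A) := by
  obtain ⟨k, hk, g, hg, rfl⟩ := hA
  exact ⟨c * k, mul_ne_zero hc hk, g, hg, by simp [smul_smul]⟩

lemma IsScalarMultipleOfG24.of_mul_right (hAB : IsScalarMultipleOfG24 (A * B))
    (hB : IsScalarMultipleOfG24 B) : IsScalarMultipleOfG24 A := by
  obtain ⟨k, hk, g, hg, hgB⟩ := hAB
  obtain ⟨l, hl, e, he, rfl⟩ := hB
  refine ⟨l⁻¹ * k, mul_ne_zero (inv_ne_zero hl) hk, g * e⁻¹, mul_mem hg (inv_mem he), ?_⟩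
  have hA : A = (l⁻¹ • (A * l • (e : Matrix (Fin 2) (Fin 2) ℂ))) *
      ((e⁻¹ : GL (Fin 2) ℂ) : Matrix (Fin 2) (Fin 2) ℂ) := by
    rw [Matrix.mul_smul, smul_smul, inv_mul_cancel₀ hl, one_smul, Matrix.mul_assoc,
      ← Units.val_mul, mul_inv_cancel, Units.val_one, Matrix.mul_one]
  rw [hA, hgB, smul_smul, Matrix.smul_mul, Units.val_mul]

lemma isScalarMultipleOfG24_one : IsScalarMultipleOfG24 1 :=
  ⟨1, one_ne_zero, 1, one_mem _, by simp⟩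

lemma isScalarMultipleOfG24_of_generator (hdet : A.det ≠ 0) (hA : A = Rx ∨ A = Ry ∨ A = Rz) :
    IsScalarMultipleOfG24 A :=
  ⟨1, one_ne_zero, GeneralLinearGroup.mkOfDetNeZero A hdet, Subgroup.subset_closure hA,
    (one_smul ℂ A).symm⟩

lemma ofReal_sqrt_two_ne_zero : (Real.sqrt 2 : ℂ) ≠ 0 := by simp

lemma isScalarMultipleOfG24_rotX : IsScalarMultipleOfG24 !![1, -I; -I, 1] := by
  have h : IsScalarMultipleOfG24 Rx := isScalarMultipleOfG24_of_generator
    (by rw [Rx, det_smul, det_fin_two_of]; norm_num) (by simp)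
  simpa [Rx, smul_smul] using h.smul ofReal_sqrt_two_ne_zero

lemma isScalarMultipleOfG24_rotY : IsScalarMultipleOfG24 !![1, -1; 1, 1] := by
  have h : IsScalarMultipleOfG24 Ry := isScalarMultipleOfG24_of_generator
    (by rw [Ry, det_smul, det_fin_two_of]; norm_num) (by simp)
  simpa [Ry, smul_smul] using h.smul ofReal_sqrt_two_ne_zero

lemma isScalarMultipleOfG24_rotZ : IsScalarMultipleOfG24 !![1, 0; 0, I] := by
  have hdet : (1 - I) * (1 + I) = 2 := by linear_combination -I_sq
  have hne : (1 - I) ≠ 0 := fun h0 => by simp [h0] at hdet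
  have h : IsScalarMultipleOfG24 Rz := isScalarMultipleOfG24_of_generator
    (by rw [Rz, det_smul, det_fin_two_of, mul_zero, sub_zero, hdet]; norm_num) (by simp)
  have h' := (h.smul ofReal_sqrt_two_ne_zero).smul (inv_ne_zero hne)
  have hI : (1 - I)⁻¹ * (1 + I) = I := by
    field_simp
    linear_combination I_sq
  simpa [Rz, smul_smul, hI, hne] using h'

lemma isScalarMultipleOfG24_diag {s t : ℂ} (hs : s ≠ 0) (hst : t ^ 4 = s ^ 4) :
    IsScalarMultipleOfG24 !![s, 0; 0, t] := by
  have hfac : (t - s) * ((t + s) * ((t - I * s) * (t + I * s))) = 0 := by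
    linear_combination hst - (t ^ 2 - s ^ 2) * s ^ 2 * I_sq
  have hZ := isScalarMultipleOfG24_rotZ
  rcases mul_eq_zero.mp hfac with h | h
  · rw [sub_eq_zero.mp h]
    convert isScalarMultipleOfG24_one.smul hs using 1
    simp [one_fin_two]
  rcases mul_eq_zero.mp h with h | h
  · rw [eq_neg_of_add_eq_zero_left h]
    simpa using (hZ.mul hZ).smul hs
  rcases mul_eq_zero.mp h with h | h
  · rw [sub_eq_zero.mp h]
    simpa [mul_comm] using hZ.smul hs
  · rw [eq_neg_of_add_eq_zero_left h]
    simpa [mul_comm] using (hZ.mul (hZ.mul hZ)).smul hs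

end ScalarMultiples

section Bell

/-- The coefficient matrices of the (unnormalised) Bell states: up to scalars, the identity and
the Pauli matrices `Z`, `X`, `Y`. -/
def bell : Fin 4 → Matrix (Fin 2) (Fin 2) ℂ :=
  ![1, !![1, 0; 0, -1], !![0, 1; 1, 0], !![0, 1; -1, 0]]

/-- Membership in the projective Pauli group. -/
def IsBellMultiple (A : Matrix (Fin 2) (Fin 2) ℂ) : Prop := ∃ (p : ℂ) (j : Fin 4), A = p • bell j

lemma IsBellMultiple.smul {A : Matrix (Fin 2) (Fin 2) ℂ} (hA : IsBellMultiple A) (c : ℂ) :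
    IsBellMultiple (c • A) := by
  obtain ⟨p, j, rfl⟩ := hA
  exact ⟨c * p, j, smul_smul _ _ _⟩

lemma isBellMultiple_bell_mul_bell (j k : Fin 4) : IsBellMultiple (bell j * bell k) := by
  fin_cases j <;> fin_cases k
  · exact ⟨1, 0, by simp [bell]⟩
  · exact ⟨1, 1, by simp [bell]⟩
  · exact ⟨1, 2, by simp [bell]⟩
  · exact ⟨1, 3, by simp [bell]⟩
  · exact ⟨1, 1, by simp [bell]⟩
  · exact ⟨1, 0, by simp [bell, one_fin_two]⟩
  · exact ⟨1, 3, by simp [bell]⟩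
  · exact ⟨1, 2, by simp [bell]⟩
  · exact ⟨1, 2, by simp [bell]⟩
  · exact ⟨-1, 3, by simp [bell]⟩
  · exact ⟨1, 0, by simp [bell, one_fin_two]⟩
  · exact ⟨-1, 1, by simp [bell]⟩
  · exact ⟨1, 3, by simp [bell]⟩
  · exact ⟨-1, 2, by simp [bell]⟩
  · exact ⟨1, 1, by simp [bell]⟩
  · exact ⟨-1, 0, by simp [bell, one_fin_two]⟩

lemma IsBellMultiple.mul {A B : Matrix (Fin 2) (Fin 2) ℂ} (hA : IsBellMultiple A)
    (hB : IsBellMultiple B) : IsBellMultiple (A * B) := by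
  obtain ⟨p, j, rfl⟩ := hA
  obtain ⟨q, k, rfl⟩ := hB
  rw [Matrix.smul_mul, Matrix.mul_smul]
  exact ((isBellMultiple_bell_mul_bell j k).smul q).smul p

lemma exists_smul_transpose_bell (i : Fin 4) : ∃ s : ℂ, s • (bell i)ᵀ = bell i := by
  fin_cases i
  · exact ⟨1, by simp [bell]⟩
  · exact ⟨1, by simp [bell, ← ext_iff]⟩
  · exact ⟨1, by simp [bell, ← ext_iff]⟩
  · exact ⟨-1, by simp [bell, ← ext_iff]⟩

lemma IsBellMultiple.transpose {A : Matrix (Fin 2) (Fin 2) ℂ} (hA : IsBellMultiple A) :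
    IsBellMultiple Aᵀ := by
  obtain ⟨p, j, rfl⟩ := hA
  rw [transpose_smul]
  refine IsBellMultiple.smul ?_ p
  fin_cases j
  · exact ⟨1, 0, by simp [bell]⟩
  · exact ⟨1, 1, by simp [bell, ← ext_iff]⟩
  · exact ⟨1, 2, by simp [bell, ← ext_iff]⟩
  · exact ⟨-1, 3, by simp [bell, ← ext_iff]⟩

lemma IsBellMultiple.inv {A : Matrix (Fin 2) (Fin 2) ℂ} (hA : IsBellMultiple A) :
    IsBellMultiple A⁻¹ := by
  obtain ⟨p, j, rfl⟩ := hA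
  rw [Matrix.inv_def]
  refine IsBellMultiple.smul ?_ _
  rw [adjugate_smul]
  refine IsBellMultiple.smul ?_ _
  fin_cases j
  · exact ⟨1, 0, by simp [bell]⟩
  · exact ⟨-1, 1, by simp [bell, adjugate_fin_two]⟩
  · exact ⟨-1, 2, by simp [bell, adjugate_fin_two]⟩
  · exact ⟨-1, 3, by simp [bell, adjugate_fin_two]⟩

/-- `O` normalises the projective Pauli group. -/
def NormalizesBell (O : Matrix (Fin 2) (Fin 2) ℂ) : Prop :=
  ∀ i, ∃ T, IsBellMultiple T ∧ bell i * O = O * T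

lemma NormalizesBell.mul {O R : Matrix (Fin 2) (Fin 2) ℂ} (hO : NormalizesBell O)
    (hR : NormalizesBell R) : NormalizesBell (O * R) := by
  intro i
  obtain ⟨_, ⟨p, j, rfl⟩, hT⟩ := hO i
  obtain ⟨S, hS, hRS⟩ := hR j
  refine ⟨p • S, hS.smul p, ?_⟩
  rw [← Matrix.mul_assoc, hT, Matrix.mul_assoc, Matrix.smul_mul, hRS, Matrix.mul_assoc,
    Matrix.mul_smul, Matrix.mul_smul, Matrix.mul_smul]

lemma normalizesBell_rotX : NormalizesBell !![1, -I; -I, 1] := by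
  intro i
  fin_cases i
  · exact ⟨_, ⟨1, 0, rfl⟩, by simp [bell]⟩
  · exact ⟨_, ⟨-I, 3, rfl⟩, by simp [bell]⟩
  · exact ⟨_, ⟨1, 2, rfl⟩, by simp [bell]⟩
  · exact ⟨_, ⟨-I, 1, rfl⟩, by simp [bell]⟩

lemma normalizesBell_rotY : NormalizesBell !![1, -1; 1, 1] := by
  intro i
  fin_cases i
  · exact ⟨_, ⟨1, 0, rfl⟩, by simp [bell]⟩
  · exact ⟨_, ⟨-1, 2, rfl⟩, by simp [bell]⟩
  · exact ⟨_, ⟨1, 1, rfl⟩, by simp [bell]⟩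
  · exact ⟨_, ⟨1, 3, rfl⟩, by simp [bell]⟩

lemma isScalarMultipleOfG24_of_diag {s t : ℂ} (hdet : s * t ≠ 0)
    (h : NormalizesBell !![s, 0; 0, t]) : IsScalarMultipleOfG24 !![s, 0; 0, t] := by
  have hs := left_ne_zero_of_mul hdet
  have ht := right_ne_zero_of_mul hdet
  obtain ⟨_, ⟨q, j, rfl⟩, hq⟩ := h 2
  refine isScalarMultipleOfG24_diag hs ?_
  fin_cases j <;> simp [bell, one_fin_two, hs, ht] at hq
  · obtain ⟨h1, h2⟩ := hq
    have : t ^ 2 = s ^ 2 := by linear_combination t * h1 - s * h2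
    linear_combination (t ^ 2 + s ^ 2) * this
  · obtain ⟨h1, h2⟩ := hq
    have : t ^ 2 = - s ^ 2 := by linear_combination t * h1 + s * h2
    linear_combination (t ^ 2 - s ^ 2) * this

lemma isScalarMultipleOfG24_of_commute {O : Matrix (Fin 2) (Fin 2) ℂ} (hdet : O.det ≠ 0)
    (h : NormalizesBell O) {p : ℂ} (hp : bell 1 * O = O * p • bell 1) :
    IsScalarMultipleOfG24 O := by
  obtain ⟨x, y, z, w, rfl⟩ : ∃ x y z w, O = !![x, y; z, w] := ⟨_, _, _, _, eta_fin_two O⟩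
  rw [det_fin_two_of] at hdet
  simp [bell] at hp
  obtain ⟨⟨h1, h2⟩, h3, h4⟩ := hp
  by_cases hx : x = 0
  · subst hx
    have hy : y ≠ 0 := by rintro rfl; simp at hdet
    have hp1 : p = -1 := by
      apply mul_left_cancel₀ hy
      linear_combination h2
    have hw : w = 0 := by
      subst hp1
      linear_combination (1 / 2 : ℂ) * h4
    subst hw
    have hX := isScalarMultipleOfG24_rotX
    have hXX := hX.mul hX
    have hN := h.mul (normalizesBell_rotX.mul normalizesBell_rotX)
    refine IsScalarMultipleOfG24.of_mul_right ?_ hXX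
    have hmul : !![0, y; z, 0] * (!![1, -I; -I, 1] * !![1, -I; -I, 1]) =
        !![y * (-I + -I), 0; 0, z * (-I + -I)] := by simp
    rw [hmul] at hN ⊢
    refine isScalarMultipleOfG24_of_diag ?_ hN
    have hz : z ≠ 0 := by rintro rfl; simp at hdet
    have hI : -I + -I ≠ 0 := by
      rw [← two_mul]
      simp
    exact mul_ne_zero (mul_ne_zero hy hI) (mul_ne_zero hz hI)
  · have hp1 : p = 1 := by
      apply mul_left_cancel₀ hx
      linear_combination -h1
    subst hp1
    have hy : y = 0 := by linear_combination (1 / 2 : ℂ) * h2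
    have hz : z = 0 := by linear_combination (-1 / 2 : ℂ) * h3
    subst hy hz
    exact isScalarMultipleOfG24_of_diag (by simpa using hdet) h

lemma NormalizesBell.isScalarMultipleOfG24 {O : Matrix (Fin 2) (Fin 2) ℂ}
    (h : NormalizesBell O) (hdet : O.det ≠ 0) : IsScalarMultipleOfG24 O := by
  obtain ⟨_, ⟨p, j, rfl⟩, hp⟩ := h 1
  fin_cases j
  · exfalso
    have hU : IsUnit O := (isUnit_iff_isUnit_det O).mpr (isUnit_iff_ne_zero.mpr hdet)
    have hZ : bell 1 = p • (1 : Matrix (Fin 2) (Fin 2) ℂ) :=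
      hU.mul_right_cancel (by simpa [bell] using hp)
    have h0 := congr_fun₂ hZ 0 0
    have h1 := congr_fun₂ hZ 1 1
    simp [bell] at h0 h1
    rw [← h0] at h1
    norm_num at h1
  · exact isScalarMultipleOfG24_of_commute hdet h hp
  · refine IsScalarMultipleOfG24.of_mul_right ?_ isScalarMultipleOfG24_rotY
    refine isScalarMultipleOfG24_of_commute (p := p) ?_ (h.mul normalizesBell_rotY) ?_
    · rw [det_mul, det_fin_two_of]
      exact mul_ne_zero hdet (by norm_num)
    · rw [← Matrix.mul_assoc, hp, Matrix.mul_assoc, Matrix.mul_assoc]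
      congr 1
      simp [bell]
  · refine IsScalarMultipleOfG24.of_mul_right ?_ isScalarMultipleOfG24_rotX
    refine isScalarMultipleOfG24_of_commute (p := -I * p) ?_ (h.mul normalizesBell_rotX) ?_
    · rw [det_mul, det_fin_two_of]
      exact mul_ne_zero hdet (by norm_num)
    · rw [← Matrix.mul_assoc, hp, Matrix.mul_assoc, Matrix.mul_assoc]
      congr 1
      simp [bell, mul_comm p, ← mul_assoc]

/-- If `U ⊗ V` permutes the Bell states up to scalars, then `U` normalises the Pauli group. -/
lemma normalizesBell_of_transpose_mul {U V : Matrix (Fin 2) (Fin 2) ℂ} (hU : U.det = 1)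
    (hV : V.det = 1) (h : ∀ i, IsBellMultiple (Uᵀ * bell i * V)) : NormalizesBell U := by
  intro i
  have hUu : IsUnit U.det := by simp [hU]
  have hVu : IsUnit V.det := by simp [hV]
  have hUt : IsUnit Uᵀ.det := by simp [hU]
  have h0 : IsBellMultiple (Uᵀ * V) := by simpa [bell] using h 0
  have key : Uᵀ * bell i * V * (Uᵀ * V)⁻¹ = Uᵀ * bell i * (Uᵀ)⁻¹ := by
    rw [Matrix.mul_inv_rev, ← Matrix.mul_assoc, mul_nonsing_inv_cancel_right _ _ hVu]
  have hT : IsBellMultiple (Uᵀ * bell i * (Uᵀ)⁻¹) := key ▸ (h i).mul h0.inv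
  have hT' := hT.transpose
  rw [transpose_mul, transpose_mul, transpose_transpose, transpose_nonsing_inv,
    transpose_transpose] at hT'
  obtain ⟨s, hs⟩ := exists_smul_transpose_bell i
  refine ⟨_, hT'.smul s, ?_⟩
  rw [Matrix.mul_smul, mul_nonsing_inv_cancel_left _ _ hUu, ← Matrix.smul_mul, hs]

end Bell

section State

/-- The coefficients of `Gstate a b c d` as a matrix along the bipartition `12|34`. -/
noncomputable def stateMatrix (a b c d : ℂ) : Matrix (Fin 2 × Fin 2) (Fin 2 × Fin 2) ℂ :=
  of fun x y => Gstate a b c d (x.1, x.2, y.1, y.2)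

/-- The coefficient vector of a two-qubit state. -/
def stateVec (A : Matrix (Fin 2) (Fin 2) ℂ) : Fin 2 × Fin 2 → ℂ := fun x => A x.1 x.2

/-- The symmetric bilinear form on two qubits preserved by local operators of determinant one. -/
def localForm : Matrix (Fin 2 × Fin 2) (Fin 2 × Fin 2) ℂ := bell 3 ⊗ₖ bell 3

lemma mul_bell_three_mul_transpose {O : Matrix (Fin 2) (Fin 2) ℂ} (hO : O.det = 1) :
    O * bell 3 * Oᵀ = bell 3 := by
  rw [det_fin_two] at hO
  ext i j
  fin_cases i <;> fin_cases j <;> simp [bell, Matrix.mul_apply, Fin.sum_univ_two] <;>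
    first | ring1 | linear_combination hO | linear_combination -hO

lemma kronecker_mul_localForm {O P : Matrix (Fin 2) (Fin 2) ℂ} (hO : O.det = 1)
    (hP : P.det = 1) : (O ⊗ₖ P) * localForm * (O ⊗ₖ P)ᵀ = localForm := by
  rw [localForm, ← kroneckerMap_transpose, ← mul_kronecker_mul, ← mul_kronecker_mul,
    mul_bell_three_mul_transpose hO, mul_bell_three_mul_transpose hP]

lemma transpose_stateMatrix (a b c d : ℂ) : (stateMatrix a b c d)ᵀ = stateMatrix a b c d := by
  ext ⟨x, y⟩ ⟨z, w⟩
  fin_cases x <;> fin_cases y <;> fin_cases z <;> fin_cases w <;> simp [stateMatrix, Gstate]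

lemma transpose_localForm : localFormᵀ = localForm := by
  ext ⟨x, y⟩ ⟨z, w⟩
  fin_cases x <;> fin_cases y <;> fin_cases z <;> fin_cases w <;> simp [localForm, bell]

lemma stateMatrix_mulVec_bell (a b c d : ℂ) (j : Fin 4) :
    stateMatrix a b c d *ᵥ stateVec (bell j) = (![a, d, b, c] j) • stateVec (bell j) := by
  ext ⟨x, y⟩
  fin_cases j <;> fin_cases x <;> fin_cases y <;>
    simp [stateMatrix, stateVec, bell, Gstate, mulVec, dotProduct, Fintype.sum_prod_type] <;> ring

lemma localForm_mulVec_bell (j : Fin 4) :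
    localForm *ᵥ stateVec (bell j) = (![1, -1, -1, 1] j : ℂ) • stateVec (bell j) := by
  ext ⟨x, y⟩
  fin_cases j <;> fin_cases x <;> fin_cases y <;>
    simp [localForm, stateVec, bell, mulVec, dotProduct, Fintype.sum_prod_type]

lemma stateMatrix_square_mulVec_bell (a b c d : ℂ) (j : Fin 4) :
    (stateMatrix a b c d * localForm * (stateMatrix a b c d)ᵀ * localForm) *ᵥ stateVec (bell j) =
      (![a, d, b, c] j) ^ 2 • stateVec (bell j) := by
  simp only [← mulVec_mulVec, transpose_stateMatrix, stateMatrix_mulVec_bell,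
    localForm_mulVec_bell, mulVec_smul, smul_smul]
  congr 1
  fin_cases j <;> simp [pow_two]

lemma bell_vecMul_stateMatrix_square (a b c d : ℂ) (j : Fin 4) :
    stateVec (bell j) ᵥ* (stateMatrix a b c d * localForm * (stateMatrix a b c d)ᵀ * localForm) =
      (![a, d, b, c] j) ^ 2 • stateVec (bell j) := by
  rw [← mulVec_transpose]
  simp only [transpose_mul, transpose_stateMatrix, transpose_localForm,
    ← mulVec_mulVec, stateMatrix_mulVec_bell, localForm_mulVec_bell, mulVec_smul, smul_smul]
  congr 1
  fin_cases j <;> simp [pow_two]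

lemma stateVec_vecMul_kronecker (W O P : Matrix (Fin 2) (Fin 2) ℂ) :
    stateVec W ᵥ* (O ⊗ₖ P) = stateVec (Oᵀ * W * P) := by
  ext ⟨x, y⟩
  simp [stateVec, vecMul, dotProduct, Fintype.sum_prod_type, Matrix.mul_apply, Fin.sum_univ_two]
  ring

lemma isBellMultiple_of_dotProduct {W : Matrix (Fin 2) (Fin 2) ℂ}
    (h : ∀ j k, j ≠ k → stateVec W ⬝ᵥ stateVec (bell j) = 0 ∨
      stateVec W ⬝ᵥ stateVec (bell k) = 0) : IsBellMultiple W := by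
  have hW : W = ∑ j, ((1 / 2 : ℂ) * (stateVec W ⬝ᵥ stateVec (bell j))) • bell j := by
    ext x y
    fin_cases x <;> fin_cases y <;>
      simp [Fin.sum_univ_four, stateVec, bell, dotProduct, Fintype.sum_prod_type] <;> ring
  by_cases hj : ∃ j, stateVec W ⬝ᵥ stateVec (bell j) ≠ 0
  · obtain ⟨j, hj⟩ := hj
    refine ⟨_, j, hW.trans (Finset.sum_eq_single j ?_ (by simp))⟩
    intro k _ hk
    rw [(h k j hk).resolve_right hj, mul_zero, zero_smul]
  · push Not at hj
    exact ⟨0, 0, by rw [hW]; simp [hj]⟩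

lemma kronecker_mul_stateMatrix {a b c d a' b' c' d' κ : ℂ}
    {O₁ O₂ O₃ O₄ : Matrix (Fin 2) (Fin 2) ℂ}
    (h : act4 O₁ O₂ O₃ O₄ (Gstate a b c d) = κ • Gstate a' b' c' d') :
    (O₁ ⊗ₖ O₂) * stateMatrix a b c d * (O₃ ⊗ₖ O₄)ᵀ = κ • stateMatrix a' b' c' d' := by
  ext ⟨x, y⟩ ⟨z, w⟩
  have hxyzw := congr_fun h (x, y, z, w)
  simp only [Pi.smul_apply] at hxyzw
  simp only [Matrix.smul_apply, stateMatrix, of_apply, ← hxyzw]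
  simp [act4, Matrix.mul_apply, Fintype.sum_prod_type, Fin.sum_univ_two]
  ring

/-- Local operators intertwine the two-qubit operators `M K Mᵀ K` built from the states. -/
lemma kronecker_mul_intertwine {a b c d a' b' c' d' κ : ℂ}
    {O₁ O₂ O₃ O₄ : Matrix (Fin 2) (Fin 2) ℂ}
    (h₁ : O₁.det = 1) (h₂ : O₂.det = 1) (h₃ : O₃.det = 1) (h₄ : O₄.det = 1)
    (h : act4 O₁ O₂ O₃ O₄ (Gstate a b c d) = κ • Gstate a' b' c' d') :
    (O₁ ⊗ₖ O₂) * (stateMatrix a b c d * localForm * (stateMatrix a b c d)ᵀ * localForm) =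
      κ ^ 2 • (stateMatrix a' b' c' d' * localForm * (stateMatrix a' b' c' d')ᵀ * localForm) *
        (O₁ ⊗ₖ O₂) := by
  have hM := kronecker_mul_stateMatrix h
  have hA : (O₁ ⊗ₖ O₂)ᵀ * localForm * (O₁ ⊗ₖ O₂) = localForm := by
    simpa [kroneckerMap_transpose] using kronecker_mul_localForm
      ((det_transpose O₁).trans h₁) ((det_transpose O₂).trans h₂)
  have hB : (O₃ ⊗ₖ O₄)ᵀ * localForm * (O₃ ⊗ₖ O₄) = localForm := by
    simpa [kroneckerMap_transpose] using kronecker_mul_localForm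
      ((det_transpose O₃).trans h₃) ((det_transpose O₄).trans h₄)
  generalize O₁ ⊗ₖ O₂ = A at *
  generalize O₃ ⊗ₖ O₄ = B at *
  generalize stateMatrix a b c d = M at *
  generalize stateMatrix a' b' c' d' = M' at *
  calc A * (M * localForm * Mᵀ * localForm)
      = A * (M * (Bᵀ * localForm * B) * Mᵀ * (Aᵀ * localForm * A)) := by rw [hA, hB]
    _ = (A * M * Bᵀ) * localForm * (A * M * Bᵀ)ᵀ * localForm * A := by
        simp only [transpose_mul, transpose_transpose, Matrix.mul_assoc]
    _ = κ ^ 2 • (M' * localForm * M'ᵀ * localForm) * A := by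
        rw [hM]
        simp [smul_smul, pow_two]

lemma isBellMultiple_transpose_mul_bell_mul {a b c d a' b' c' d' κ : ℂ}
    {O₁ O₂ O₃ O₄ : Matrix (Fin 2) (Fin 2) ℂ}
    (hab : a ^ 2 ≠ b ^ 2) (hac : a ^ 2 ≠ c ^ 2) (had : a ^ 2 ≠ d ^ 2)
    (hbc : b ^ 2 ≠ c ^ 2) (hbd : b ^ 2 ≠ d ^ 2) (hcd : c ^ 2 ≠ d ^ 2)
    (h₁ : O₁.det = 1) (h₂ : O₂.det = 1) (h₃ : O₃.det = 1) (h₄ : O₄.det = 1)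
    (h : act4 O₁ O₂ O₃ O₄ (Gstate a b c d) = κ • Gstate a' b' c' d') (i : Fin 4) :
    IsBellMultiple (O₁ᵀ * bell i * O₂) := by
  have hinj : ∀ j k, j ≠ k → (![a, d, b, c] j) ^ 2 ≠ (![a, d, b, c] k) ^ 2 := by
    intro j k hjk
    fin_cases j <;> fin_cases k <;> simp_all [Ne.symm]
  have hw := congrArg (stateVec (bell i) ᵥ* ·) (kronecker_mul_intertwine h₁ h₂ h₃ h₄ h)
  simp only [← vecMul_vecMul (stateVec (bell i)) (O₁ ⊗ₖ O₂),
    ← vecMul_vecMul (stateVec (bell i)) (κ ^ 2 • _), vecMul_smul, bell_vecMul_stateMatrix_square,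
    smul_vecMul, stateVec_vecMul_kronecker, smul_smul] at hw
  have heig : ∀ j, stateVec (O₁ᵀ * bell i * O₂) ⬝ᵥ stateVec (bell j) ≠ 0 →
      (![a, d, b, c] j) ^ 2 = κ ^ 2 * (![a', d', b', c'] i) ^ 2 := by
    intro j hj
    have hdot := congrArg (· ⬝ᵥ stateVec (bell j)) hw
    simp only [← dotProduct_mulVec, stateMatrix_square_mulVec_bell, dotProduct_smul, smul_dotProduct,
      smul_eq_mul] at hdot
    exact mul_right_cancel₀ hj hdot
  refine isBellMultiple_of_dotProduct fun j k hjk => ?_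
  by_contra! hne
  exact hinj j k hjk ((heig j hne.1).trans (heig k hne.2).symm)

lemma isScalarMultipleOfG24_pair {a b c d a' b' c' d' κ : ℂ}
    {O₁ O₂ O₃ O₄ : Matrix (Fin 2) (Fin 2) ℂ}
    (hab : a ^ 2 ≠ b ^ 2) (hac : a ^ 2 ≠ c ^ 2) (had : a ^ 2 ≠ d ^ 2)
    (hbc : b ^ 2 ≠ c ^ 2) (hbd : b ^ 2 ≠ d ^ 2) (hcd : c ^ 2 ≠ d ^ 2)
    (h₁ : O₁.det = 1) (h₂ : O₂.det = 1) (h₃ : O₃.det = 1) (h₄ : O₄.det = 1)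
    (h : act4 O₁ O₂ O₃ O₄ (Gstate a b c d) = κ • Gstate a' b' c' d') :
    IsScalarMultipleOfG24 O₁ ∧ IsScalarMultipleOfG24 O₂ := by
  have hW := isBellMultiple_transpose_mul_bell_mul hab hac had hbc hbd hcd h₁ h₂ h₃ h₄ h
  have hW' : ∀ i, IsBellMultiple (O₂ᵀ * bell i * O₁) := by
    intro i
    obtain ⟨s, hs⟩ := exists_smul_transpose_bell i
    have := ((hW i).transpose).smul s
    rwa [transpose_mul, transpose_mul, transpose_transpose, ← Matrix.mul_assoc, ← Matrix.smul_mul,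
      ← Matrix.mul_smul, hs] at this
  exact ⟨(normalizesBell_of_transpose_mul h₁ h₂ hW).isScalarMultipleOfG24 (by simp [h₁]),
    (normalizesBell_of_transpose_mul h₂ h₁ hW').isScalarMultipleOfG24 (by simp [h₂])⟩

lemma Gstate_swap (a b c d : ℂ) (x y z w : Fin 2) :
    Gstate a b c d (z, w, x, y) = Gstate a b c d (x, y, z, w) := by
  fin_cases x <;> fin_cases y <;> fin_cases z <;> fin_cases w <;> simp [Gstate]

lemma act4_swap (O₁ O₂ O₃ O₄ : Matrix (Fin 2) (Fin 2) ℂ) (a b c d : ℂ) (x y z w : Fin 2) :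
    act4 O₃ O₄ O₁ O₂ (Gstate a b c d) (z, w, x, y) =
      act4 O₁ O₂ O₃ O₄ (Gstate a b c d) (x, y, z, w) := by
  simp [act4, Fintype.sum_prod_type, Gstate]
  ring

end State

/-- Supplementary Lemma: any local `SL(2,ℂ)^{⊗4}` operator relating two generic
`G_{abcd}` states has all its local factors in the group `𝒢₂₄`, up to scalars. -/
theorem local_factors_in_G24 (a b c d a' b' c' d' : ℂ)
    (hab : a ^ 2 ≠ b ^ 2) (hac : a ^ 2 ≠ c ^ 2) (had : a ^ 2 ≠ d ^ 2)
    (hbc : b ^ 2 ≠ c ^ 2) (hbd : b ^ 2 ≠ d ^ 2) (hcd : c ^ 2 ≠ d ^ 2)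
    (O₁ O₂ O₃ O₄ : Matrix (Fin 2) (Fin 2) ℂ)
    (h₁ : O₁.det = 1) (h₂ : O₂.det = 1) (h₃ : O₃.det = 1) (h₄ : O₄.det = 1)
    (κ : ℂ) (hκ : κ ≠ 0)
    (h : act4 O₁ O₂ O₃ O₄ (Gstate a b c d) = κ • Gstate a' b' c' d') :
    IsScalarMultipleOfG24 O₁ ∧ IsScalarMultipleOfG24 O₂ ∧
      IsScalarMultipleOfG24 O₃ ∧ IsScalarMultipleOfG24 O₄ := by
  have h₁₂ := isScalarMultipleOfG24_pair hab hac had hbc hbd hcd h₁ h₂ h₃ h₄ h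
  have h_swap : act4 O₃ O₄ O₁ O₂ (Gstate a b c d) = κ • Gstate a' b' c' d' := by
    ext ⟨z, w, x, y⟩
    rw [act4_swap, h, Pi.smul_apply, Pi.smul_apply, Gstate_swap]
  exact ⟨h₁₂.1, h₁₂.2, isScalarMultipleOfG24_pair hab hac had hbc hbd hcd h₃ h₄ h₁ h₂ h_swap⟩
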